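/- arXiv:1209.4687 — 2 statements merged into one kernel-verified Lean document; each statement's English description precedes it below -/
import Mathlib

section
/- For every 0 < q < 1 and γ > 0, the mutual information functional I(μ) attains its maximum over Λ(γ,q), and the maximizing probability measure μ₀ ∈ Λ(γ,q) is unique. -/
open MeasureTheory Real Filter

/-- The standard Gaussian density `φ(t) = (2π)^{-1/2} e^{-t²/2}`. -/
noncomputable def gauss (t : ℝ) : ℝ := Real.exp (-t ^ 2 / 2) / Real.sqrt (2 * Real.pi)

/-- The output density `p_Y(y;μ) = ∫ φ(y−x) dμ(x)`. -/
noncomputable def outDen (μ : Measure ℝ) (y : ℝ) : ℝ := ∫ x, gauss (y - x) ∂μ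

/-- The relative entropy `d(x;μ) = ∫ φ(y−x) log(φ(y−x)/p_Y(y;μ)) dy`. -/
noncomputable def relEnt (x : ℝ) (μ : Measure ℝ) : ℝ :=
  ∫ y, gauss (y - x) * Real.log (gauss (y - x) / outDen μ y)

/-- The mutual information `I(μ) = ∫ d(x;μ) dμ(x)`. -/
noncomputable def mutInfo (μ : Measure ℝ) : ℝ := ∫ x, relEnt x μ ∂μ

/-- The constraint set `Λ(γ,q)`: probability measures with `μ({0}) ≥ q` and second moment
at most `γ`. -/
def memLam (γ q : ℝ) (μ : Measure ℝ) : Prop :=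
  IsProbabilityMeasure μ ∧ ENNReal.ofReal q ≤ μ {0} ∧
    ∫⁻ x, ENNReal.ofReal (x ^ 2) ∂μ ≤ ENNReal.ofReal γ

open ProbabilityTheory in
lemma gauss_eq_pdf (x y : ℝ) : gauss (y - x) = gaussianPDFReal x 1 y := by
  simp only [gauss, gaussianPDFReal, NNReal.coe_one, mul_one]
  rw [div_eq_inv_mul]

lemma continuous_gauss : Continuous gauss := by
  unfold gauss; fun_prop

lemma gauss_pos (t : ℝ) : 0 < gauss t := by
  unfold gauss; positivity

lemma one_lt_sqrt_two_pi : 1 < √(2 * π) := by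
  rw [Real.lt_sqrt zero_le_one]; nlinarith [Real.pi_gt_three]

lemma gauss_le_one (t : ℝ) : gauss t ≤ 1 := by
  unfold gauss
  rw [div_le_one (by positivity)]
  refine le_trans ?_ one_lt_sqrt_two_pi.le
  rw [Real.exp_le_one_iff]; nlinarith [sq_nonneg t]

lemma log_gauss (t : ℝ) : Real.log (gauss t) = -t ^ 2 / 2 - Real.log √(2 * π) := by
  unfold gauss
  rw [Real.log_div (by positivity) (by positivity), Real.log_exp]

open ProbabilityTheory in
lemma integrable_gauss_smul_iff {E : Type*} [NormedAddCommGroup E] [NormedSpace ℝ E]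
    (x : ℝ) (g : ℝ → E) :
    Integrable (fun y => gauss (y - x) • g y) ↔ Integrable g (gaussianReal x 1) := by
  rw [gaussianReal_of_var_ne_zero _ one_ne_zero,
    integrable_withDensity_iff_integrable_smul₀' (measurable_gaussianPDF _ _).aemeasurable
      (ae_of_all _ fun _ ↦ gaussianPDF_lt_top)]
  simp [gauss_eq_pdf]

open ProbabilityTheory in
lemma integral_gauss_smul {E : Type*} [NormedAddCommGroup E] [NormedSpace ℝ E]
    (x : ℝ) (g : ℝ → E) :
    ∫ y, gauss (y - x) • g y = ∫ y, g y ∂(gaussianReal x 1) := by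
  rw [integral_gaussianReal_eq_integral_smul one_ne_zero]
  simp [gauss_eq_pdf]

open ProbabilityTheory in
lemma integrable_quad (x A B : ℝ) : Integrable (fun y => A * y ^ 2 + B) (gaussianReal x 1) := by
  have h := (memLp_id_gaussianReal (μ := x) (v := 1) 2).integrable_sq
  simp only [id] at h
  exact (h.const_mul A).add (integrable_const B)

open ProbabilityTheory in
lemma integral_quad (x A B : ℝ) :
    ∫ y, (A * y ^ 2 + B) ∂(gaussianReal x 1) = A * (x ^ 2 + 1) + B := by
  have h := (memLp_id_gaussianReal (μ := x) (v := 1) 2).integrable_sq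
  have h2 := variance_eq_sub (memLp_id_gaussianReal (μ := x) (v := 1) 2)
  simp only [id] at h
  rw [integral_add (h.const_mul A) (integrable_const B), integral_const_mul]
  have : ∫ y, y ^ 2 ∂(gaussianReal x 1) = x ^ 2 + 1 := by
    have h3 : Var[id; gaussianReal x 1] = 1 := by simp
    rw [h3] at h2
    simp only [id_eq, Pi.pow_apply, integral_id_gaussianReal] at h2
    linarith
  rw [this]; simp

lemma integrable_sq_of {γ : ℝ} {μ : Measure ℝ}
    (h : ∫⁻ x, ENNReal.ofReal (x ^ 2) ∂μ ≤ ENNReal.ofReal γ) :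
    Integrable (fun x => x ^ 2) μ := by
  refine ⟨by fun_prop, ?_⟩
  rw [hasFiniteIntegral_iff_ofReal (ae_of_all _ fun x => sq_nonneg x)]
  exact h.trans_lt ENNReal.ofReal_lt_top

lemma integral_sq_le {γ : ℝ} (hγ : 0 ≤ γ) {μ : Measure ℝ}
    (h : ∫⁻ x, ENNReal.ofReal (x ^ 2) ∂μ ≤ ENNReal.ofReal γ) :
    ∫ x, x ^ 2 ∂μ ≤ γ := by
  rw [integral_eq_lintegral_of_nonneg_ae (ae_of_all _ fun x => sq_nonneg x) (by fun_prop)]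
  exact ENNReal.toReal_le_of_le_ofReal hγ h

lemma integrable_gauss_sub (μ : Measure ℝ) [IsFiniteMeasure μ] (y : ℝ) :
    Integrable (fun x => gauss (y - x)) μ := by
  refine Integrable.of_bound (C := 1) ?_ (ae_of_all _ fun x => ?_)
  · exact (continuous_gauss.comp (by fun_prop)).aestronglyMeasurable
  · rw [Real.norm_of_nonneg (gauss_pos _).le]; exact gauss_le_one _

/-- Fubini against the Gaussian kernel. -/
lemma fubini_gauss {E : Type*} [NormedAddCommGroup E] [NormedSpace ℝ E] [CompleteSpace E]
    [MeasurableSpace E] [BorelSpace E] [SecondCountableTopology E]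
    (μ : Measure ℝ) [IsProbabilityMeasure μ] (hμ : Integrable (fun x => x ^ 2) μ)
    (g : ℝ → E) (hg : Continuous g) (A B : ℝ) (hb : ∀ y, ‖g y‖ ≤ A * y ^ 2 + B) :
    Integrable (fun y => outDen μ y • g y) ∧
    Integrable (fun x => ∫ y, gauss (y - x) • g y) μ ∧
    ∫ x, (∫ y, gauss (y - x) • g y) ∂μ = ∫ y, outDen μ y • g y := by
  have hF : Continuous (fun z : ℝ × ℝ => gauss (z.2 - z.1) • g z.2) :=
    (continuous_gauss.comp (by fun_prop)).smul (hg.comp continuous_snd)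
  have hgi : ∀ x, Integrable g (ProbabilityTheory.gaussianReal x 1) := fun x =>
    (integrable_quad x A B).mono' hg.aestronglyMeasurable (ae_of_all _ hb)
  have hFint : Integrable (fun z : ℝ × ℝ => gauss (z.2 - z.1) • g z.2) (μ.prod volume) := by
    rw [integrable_prod_iff hF.aestronglyMeasurable]
    refine ⟨ae_of_all _ fun x => (integrable_gauss_smul_iff x g).2 (hgi x), ?_⟩
    refine Integrable.mono' (g := fun x => A * (x ^ 2 + 1) + B) ?_ ?_ (ae_of_all _ fun x => ?_)
    · exact ((hμ.add (integrable_const 1)).const_mul A).add (integrable_const B)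
    · exact (hF.norm.stronglyMeasurable.integral_prod_right').aestronglyMeasurable
    · simp only [norm_smul, Real.norm_of_nonneg (gauss_pos _).le]
      rw [Real.norm_of_nonneg (integral_nonneg fun y => mul_nonneg (gauss_pos _).le (norm_nonneg _))]
      have := integral_gauss_smul x (fun y => ‖g y‖)
      simp only [smul_eq_mul] at this
      rw [this, ← integral_quad]
      exact integral_mono (hgi x).norm (integrable_quad x A B) hb
  have hsm : ∀ y, ∫ x, gauss (y - x) • g y ∂μ = outDen μ y • g y := fun y => by
    rw [integral_smul_const]; rfl
  refine ⟨?_, hFint.integral_prod_left, ?_⟩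
  · have := hFint.integral_prod_right
    simpa only [hsm] using this
  · rw [integral_integral_swap hFint]
    simp only [hsm]

lemma continuous_outDen (μ : Measure ℝ) [IsProbabilityMeasure μ] : Continuous (outDen μ) := by
  unfold outDen
  refine continuous_of_dominated (bound := fun _ => 1) ?_ ?_ (integrable_const _) ?_
  · intro y; exact (integrable_gauss_sub μ y).aestronglyMeasurable
  · intro y; refine ae_of_all _ fun x => ?_
    rw [Real.norm_of_nonneg (gauss_pos _).le]; exact gauss_le_one _
  · exact ae_of_all _ fun x => continuous_gauss.comp (by fun_prop)

lemma outDen_le_one (μ : Measure ℝ) [IsProbabilityMeasure μ] (y : ℝ) : outDen μ y ≤ 1 := by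
  have := integral_mono (integrable_gauss_sub μ y) (integrable_const 1) (fun x => gauss_le_one _)
  simpa [outDen] using this

lemma le_outDen {γ q : ℝ} {μ : Measure ℝ} (h : memLam γ q μ) (y : ℝ) :
    q * gauss y ≤ outDen μ y := by
  have := h.1
  have h1 : q ≤ μ.real {0} := by
    rw [Measure.real]
    exact (ENNReal.ofReal_le_iff_le_toReal (measure_ne_top _ _)).1 h.2.1
  have h2 : ∫ x in ({0} : Set ℝ), gauss (y - x) ∂μ ≤ outDen μ y :=
    setIntegral_le_integral (integrable_gauss_sub μ y) (ae_of_all _ fun x => (gauss_pos _).le)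
  rw [integral_singleton] at h2
  simp only [sub_zero, smul_eq_mul] at h2
  exact (mul_le_mul_of_nonneg_right h1 (gauss_pos y).le).trans h2

lemma outDen_pos {γ q : ℝ} (hq : 0 < q) {μ : Measure ℝ} (h : memLam γ q μ) (y : ℝ) :
    0 < outDen μ y := (mul_pos hq (gauss_pos y)).trans_le (le_outDen h y)

lemma neg_log_outDen_le {γ q : ℝ} (hq : 0 < q) {μ : Measure ℝ} (h : memLam γ q μ) (y : ℝ) :
    ‖-Real.log (outDen μ y)‖ ≤ 1 / 2 * y ^ 2 + (Real.log √(2 * π) - Real.log q) := by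
  have := h.1
  rw [Real.norm_of_nonneg
    (neg_nonneg.2 (Real.log_nonpos (outDen_pos hq h y).le (outDen_le_one μ y)))]
  have h1 := Real.log_le_log (mul_pos hq (gauss_pos y)) (le_outDen h y)
  rw [Real.log_mul hq.ne' (gauss_pos y).ne', log_gauss] at h1
  linarith

lemma integrable_gauss_log (x : ℝ) :
    Integrable (fun y => gauss (y - x) * Real.log (gauss (y - x))) := by
  have h : Integrable (fun y => gauss y * Real.log (gauss y)) := by
    have := (integrable_gauss_smul_iff 0 (fun y => (-1 / 2) * y ^ 2 + (-Real.log √(2 * π)))).2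
      (integrable_quad 0 _ _)
    refine this.congr (ae_of_all _ fun y => ?_)
    simp only [sub_zero, smul_eq_mul, log_gauss]; ring
  exact h.comp_sub_right x

lemma continuous_log_outDen {γ q : ℝ} (hq : 0 < q) {μ : Measure ℝ} (h : memLam γ q μ) :
    Continuous (fun y => -Real.log (outDen μ y)) := by
  have := h.1
  exact ((continuous_outDen μ).log fun y => (outDen_pos hq h y).ne').neg

lemma mutInfo_formula {γ q : ℝ} (hq : 0 < q) {μ : Measure ℝ} (h : memLam γ q μ) :
    Integrable (fun y => negMulLog (outDen μ y)) ∧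
    mutInfo μ = (∫ y, gauss y * Real.log (gauss y)) + ∫ y, negMulLog (outDen μ y) := by
  have := h.1
  obtain ⟨h1, h2, h3⟩ := fubini_gauss μ (integrable_sq_of h.2.2) _ (continuous_log_outDen hq h) _ _
    (neg_log_outDen_le hq h)
  have he : ∀ y, outDen μ y • (-Real.log (outDen μ y)) = negMulLog (outDen μ y) := fun y => by
    simp [negMulLog]
  simp only [he] at h1 h3
  refine ⟨h1, ?_⟩
  have hrel : ∀ x, relEnt x μ = (∫ y, gauss y * Real.log (gauss y)) +
      ∫ y, gauss (y - x) • (-Real.log (outDen μ y)) := fun x => by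
    rw [← integral_sub_right_eq_self (fun y => gauss y * Real.log (gauss y)) x,
      ← integral_add (integrable_gauss_log x)]
    · unfold relEnt
      congr 1; ext y
      rw [Real.log_div (gauss_pos _).ne' (outDen_pos hq h y).ne', smul_eq_mul]; ring
    · rw [integrable_gauss_smul_iff]
      exact (integrable_quad x _ _).mono' (continuous_log_outDen hq h).aestronglyMeasurable
        (ae_of_all _ (neg_log_outDen_le hq h))
  unfold mutInfo
  simp only [hrel]
  rw [integral_add (integrable_const _) h2, h3]
  simp

lemma sq_outDen {γ q : ℝ} (hγ : 0 < γ) {μ : Measure ℝ} (h : memLam γ q μ) :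
    Integrable (fun y => outDen μ y * y ^ 2) ∧ ∫ y, outDen μ y * y ^ 2 ≤ γ + 1 := by
  have := h.1
  obtain ⟨h1, h2, h3⟩ := fubini_gauss μ (integrable_sq_of h.2.2) (fun y : ℝ => y ^ 2) (by fun_prop)
    1 0 (fun y => by simp)
  simp only [smul_eq_mul] at h1 h3
  refine ⟨h1, ?_⟩
  rw [← h3]
  have h4 : ∀ x : ℝ, ∫ y, gauss (y - x) * y ^ 2 = x ^ 2 + 1 := fun x => by
    have h5 := integral_gauss_smul x (fun y => y ^ 2)
    have h6 := integral_quad x 1 0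
    simp only [smul_eq_mul] at h5
    simp only [one_mul, add_zero] at h6
    rw [h5, h6]
  simp only [h4]
  rw [integral_add (integrable_sq_of h.2.2) (integrable_const _)]
  simpa using integral_sq_le hγ.le h.2.2

lemma negMulLog_le_fenchel {p : ℝ} (hp : 0 < p) (c : ℝ) :
    negMulLog p ≤ p * c + Real.exp (-1 - c) := by
  have h := Real.log_le_sub_one_of_pos (div_pos (Real.exp_pos (-1 - c)) hp)
  rw [Real.log_div (Real.exp_pos _).ne' hp.ne', Real.log_exp] at h
  have h2 : -Real.log p - c ≤ Real.exp (-1 - c) / p := by linarith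
  rw [le_div_iff₀ hp] at h2
  unfold negMulLog; linarith

/-- nonnegative defect -/
noncomputable def defect (ε y p : ℝ) : ℝ :=
  ε * (p * y ^ 2) + Real.exp (-1 - ε * y ^ 2) - negMulLog p

lemma continuous_defect (ε : ℝ) : Continuous (fun z : ℝ × ℝ => defect ε z.1 z.2) := by
  unfold defect
  have := Real.continuous_negMulLog
  fun_prop

lemma defect_nonneg {p : ℝ} (hp : 0 < p) (ε y : ℝ) : 0 ≤ defect ε y p := by
  have := negMulLog_le_fenchel hp (ε * y ^ 2)
  unfold defect; linarith

lemma integrable_exp_aux {ε : ℝ} (hε : 0 < ε) :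
    Integrable (fun y : ℝ => Real.exp (-1 - ε * y ^ 2)) := by
  have := (integrable_exp_neg_mul_sq hε).const_mul (Real.exp (-1))
  refine this.congr (ae_of_all _ fun y => ?_)
  simp only
  rw [← Real.exp_add]; ring_nf

lemma integral_defect {γ q ε : ℝ} (hq : 0 < q) (hγ : 0 < γ) (hε : 0 < ε) {μ : Measure ℝ}
    (h : memLam γ q μ) :
    Integrable (fun y => defect ε y (outDen μ y)) ∧
    ∫ y, defect ε y (outDen μ y) = ε * (∫ y, outDen μ y * y ^ 2) +
      (∫ y : ℝ, Real.exp (-1 - ε * y ^ 2)) - ∫ y, negMulLog (outDen μ y) := by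
  have h1 := (sq_outDen hγ h).1.const_mul ε
  have h2 := integrable_exp_aux hε
  have h3 := (mutInfo_formula hq h).1
  have h12 : Integrable (fun y => ε * (outDen μ y * y ^ 2) + Real.exp (-1 - ε * y ^ 2)) :=
    h1.add h2
  refine ⟨h12.sub h3, ?_⟩
  unfold defect
  rw [integral_sub h12 h3, integral_add h1 h2, integral_const_mul]

lemma entropy_le {γ q ε : ℝ} (hq : 0 < q) (hγ : 0 < γ) (hε : 0 < ε) {μ : Measure ℝ}
    (h : memLam γ q μ) :
    ∫ y, negMulLog (outDen μ y) ≤ ε * (γ + 1) + ∫ y : ℝ, Real.exp (-1 - ε * y ^ 2) := by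
  have h1 := (integral_defect hq hγ hε h).2
  have h2 : 0 ≤ ∫ y, defect ε y (outDen μ y) :=
    integral_nonneg fun y => defect_nonneg (outDen_pos hq h y) ε y
  have h3 := mul_le_mul_of_nonneg_left (sq_outDen hγ h).2 hε.le
  linarith

lemma tendsto_outDen {μ : ProbabilityMeasure ℝ} {μs : ℕ → ProbabilityMeasure ℝ}
    (hlim : Tendsto μs atTop (nhds μ)) (y : ℝ) :
    Tendsto (fun n => outDen (μs n) y) atTop (nhds (outDen μ y)) := by
  have h := (ProbabilityMeasure.tendsto_iff_forall_integral_tendsto.1 hlim)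
    (BoundedContinuousFunction.ofNormedAddCommGroup (fun x => gauss (y - x))
      (continuous_gauss.comp (by fun_prop)) 1 (fun x => by
        rw [Real.norm_of_nonneg (gauss_pos _).le]; exact gauss_le_one _))
  exact h

lemma entropy_usc {γ q : ℝ} (hq : 0 < q) (hγ : 0 < γ) {μ : ProbabilityMeasure ℝ}
    {μs : ℕ → ProbabilityMeasure ℝ} (hlim : Tendsto μs atTop (nhds μ))
    (hs : ∀ n, memLam γ q (μs n)) (hm : memLam γ q μ) {S : ℝ}
    (hS : Tendsto (fun n => ∫ y, negMulLog (outDen (μs n) y)) atTop (nhds S)) :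
    S ≤ ∫ y, negMulLog (outDen μ y) := by
  have key : ∀ ε : ℝ, 0 < ε → S ≤ (∫ y, negMulLog (outDen μ y)) + ε * (γ + 1) := by
    intro ε hε
    set K := ∫ y : ℝ, Real.exp (-1 - ε * y ^ 2) with hK
    have hmeas : ∀ ν : ProbabilityMeasure ℝ,
        Measurable (fun y => ENNReal.ofReal (defect ε y (outDen ν y))) := fun ν =>
      ENNReal.measurable_ofReal.comp
        ((continuous_defect ε).comp (continuous_id.prodMk (continuous_outDen (ν : Measure ℝ)))).measurable
    have hconv : ∀ y, Tendsto (fun n => ENNReal.ofReal (defect ε y (outDen (μs n) y))) atTop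
        (nhds (ENNReal.ofReal (defect ε y (outDen μ y)))) := fun y =>
      ENNReal.tendsto_ofReal (((continuous_defect ε).comp
        (continuous_const.prodMk continuous_id)).continuousAt.tendsto.comp (tendsto_outDen hlim y))
    have hfat := lintegral_liminf_le (μ := volume) (u := atTop) (fun n => hmeas (μs n))
    simp only [fun y => (hconv y).liminf_eq] at hfat
    have hval : ∀ ν : ProbabilityMeasure ℝ, memLam γ q ν →
        ∫⁻ y, ENNReal.ofReal (defect ε y (outDen ν y)) =
          ENNReal.ofReal (∫ y, defect ε y (outDen ν y)) := fun ν hν =>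
      (ofReal_integral_eq_lintegral_ofReal (integral_defect hq hγ hε hν).1
        (ae_of_all _ fun y => defect_nonneg (outDen_pos hq hν y) ε y)).symm
    have hb : ∀ n, ∫⁻ y, ENNReal.ofReal (defect ε y (outDen (μs n) y)) ≤
        ENNReal.ofReal (ε * (γ + 1) + K - ∫ y, negMulLog (outDen (μs n) y)) := fun n => by
      rw [hval _ (hs n)]
      apply ENNReal.ofReal_le_ofReal
      rw [(integral_defect hq hγ hε (hs n)).2]
      have := mul_le_mul_of_nonneg_left (sq_outDen hγ (hs n)).2 hε.le
      linarith
    have hlimb : Tendsto (fun n => ENNReal.ofReal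
        (ε * (γ + 1) + K - ∫ y, negMulLog (outDen (μs n) y))) atTop
        (nhds (ENNReal.ofReal (ε * (γ + 1) + K - S))) :=
      ENNReal.tendsto_ofReal (tendsto_const_nhds.sub hS)
    have h1 := hfat.trans ((liminf_le_liminf (Eventually.of_forall hb)).trans hlimb.liminf_eq.le)
    have hSle : S ≤ ε * (γ + 1) + K :=
      le_of_tendsto' hS fun n => entropy_le hq hγ hε (hs n)
    rw [hval μ hm, ENNReal.ofReal_le_ofReal_iff (by linarith),
      (integral_defect hq hγ hε hm).2] at h1
    have h2 : 0 ≤ ε * ∫ y, outDen μ y * y ^ 2 :=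
      mul_nonneg hε.le (integral_nonneg fun y => mul_nonneg (outDen_pos hq hm y).le (sq_nonneg y))
    linarith
  refine le_of_forall_pos_le_add fun δ hδ => ?_
  have := key (δ / (γ + 1)) (by positivity)
  rwa [div_mul_cancel₀ _ (by positivity)] at this

lemma memLam_closed {γ q : ℝ} {μ : ProbabilityMeasure ℝ}
    {μs : ℕ → ProbabilityMeasure ℝ} (hlim : Tendsto μs atTop (nhds μ))
    (hs : ∀ n, memLam γ q (μs n)) : memLam γ q μ := by
  refine ⟨inferInstance, ?_, ?_⟩
  · refine le_trans ?_ (ProbabilityMeasure.limsup_measure_closed_le_of_tendsto hlim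
      (isClosed_singleton (x := (0 : ℝ))))
    exact le_limsup_of_frequently_le (Frequently.of_forall fun n => (hs n).2.1)
  · refine (lintegral_le_liminf_lintegral_of_forall_isOpen_measure_le_liminf_measure
      (f := fun x : ℝ => x ^ 2) (by fun_prop) (fun x => sq_nonneg x)
      (fun G hG => ProbabilityMeasure.le_liminf_measure_open_of_tendsto hlim hG)).trans ?_
    exact liminf_le_of_frequently_le' (Frequently.of_forall fun n => (hs n).2.2)

lemma memLam_tight (γ q : ℝ) :
    IsTightMeasureSet {((μ : ProbabilityMeasure ℝ) : Measure ℝ) |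
      μ ∈ {μ : ProbabilityMeasure ℝ | memLam γ q μ}} := by
  apply isTightMeasureSet_of_tendsto_measure_norm_gt
  have hlim : Tendsto (fun r : ℝ => ENNReal.ofReal γ / ENNReal.ofReal (r ^ 2)) atTop (nhds 0) := by
    have h1 : Tendsto (fun r : ℝ => ENNReal.ofReal (r ^ 2)) atTop (nhds ⊤) :=
      ENNReal.tendsto_ofReal_atTop.comp (tendsto_pow_atTop two_ne_zero)
    have := ENNReal.Tendsto.const_div (a := ENNReal.ofReal γ) h1 (Or.inr ENNReal.ofReal_ne_top)
    simpa using this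
  refine tendsto_of_tendsto_of_tendsto_of_le_of_le' tendsto_const_nhds hlim
    (Eventually.of_forall fun _ => zero_le) ?_
  filter_upwards [eventually_gt_atTop 0] with r hr
  refine iSup₂_le fun ν hν => ?_
  obtain ⟨μ, hμ, rfl⟩ := hν
  have hr2 : 0 < r ^ 2 := by positivity
  have hsub : {x : ℝ | r < ‖x‖} ⊆ {x : ℝ | ENNReal.ofReal (r ^ 2) ≤ ENNReal.ofReal (x ^ 2)} := by
    intro x hx
    apply ENNReal.ofReal_le_ofReal
    have hx' : r < |x| := hx
    rw [← sq_abs x]; nlinarith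
  refine (measure_mono hsub).trans ?_
  refine (meas_ge_le_lintegral_div (by fun_prop) (by simpa using hr.ne') ENNReal.ofReal_ne_top).trans ?_
  gcongr
  exact hμ.2.2

lemma exists_maximizer {γ q : ℝ} (hq : 0 < q) (hq1 : q < 1) (hγ : 0 < γ) :
    ∃ μ₀ : Measure ℝ, memLam γ q μ₀ ∧ ∀ μ, memLam γ q μ → mutInfo μ ≤ mutInfo μ₀ := by
  set Λ : Set (ProbabilityMeasure ℝ) := {μ | memLam γ q μ} with hΛ
  have hd : memLam γ q (Measure.dirac 0) := by
    refine ⟨inferInstance, ?_, ?_⟩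
    · simpa using hq1.le
    · simp
  have hne : Λ.Nonempty := ⟨⟨Measure.dirac 0, inferInstance⟩, hd⟩
  let H : ProbabilityMeasure ℝ → ℝ := fun μ => ∫ y, negMulLog (outDen μ y)
  have hbdd : BddAbove (H '' Λ) := by
    refine ⟨1 * (γ + 1) + ∫ y : ℝ, Real.exp (-1 - 1 * y ^ 2), ?_⟩
    rintro _ ⟨μ, hμ, rfl⟩
    exact entropy_le hq hγ one_pos hμ
  obtain ⟨u, -, hu, humem⟩ := exists_seq_tendsto_sSup (hne.image H) hbdd
  choose μs hμs hμu using humem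
  obtain ⟨μ, -, φ, hφ, hlim⟩ := (isCompact_closure_of_isTightMeasureSet
    (memLam_tight γ q)).tendsto_subseq (fun n => subset_closure (hμs n))
  have hm : memLam γ q μ := memLam_closed hlim (fun n => hμs (φ n))
  have hS : sSup (H '' Λ) ≤ H μ := by
    refine entropy_usc hq hγ hlim (fun n => hμs (φ n)) hm ?_
    have := hu.comp hφ.tendsto_atTop
    refine this.congr fun n => ?_
    exact (hμu (φ n)).symm
  refine ⟨μ, hm, fun ν hν => ?_⟩
  rw [(mutInfo_formula hq hν).2, (mutInfo_formula hq hm).2]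
  have := hν.1
  have h1 : H ⟨ν, hν.1⟩ ≤ sSup (H '' Λ) := le_csSup hbdd ⟨⟨ν, hν.1⟩, hν, rfl⟩
  exact add_le_add_right (h1.trans hS) _

open ProbabilityTheory in
lemma eq_of_outDen_eq {γ q : ℝ} {μ ν : Measure ℝ} (hμ : memLam γ q μ) (hν : memLam γ q ν)
    (h : outDen μ = outDen ν) : μ = ν := by
  have := hμ.1
  have := hν.1
  have key : ∀ (ρ : Measure ℝ), memLam γ q ρ → ∀ t : ℝ,
      ∫ y, outDen ρ y • Complex.exp (t * y * Complex.I) =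
        charFun ρ t * Complex.exp (-(t ^ 2 / 2)) := by
    intro ρ hρ t
    have := hρ.1
    have h3 := (fubini_gauss ρ (integrable_sq_of hρ.2.2)
      (fun y : ℝ => Complex.exp (t * y * Complex.I)) (by fun_prop) 0 1 (fun y => by
        rw [← Complex.ofReal_mul, Complex.norm_exp_ofReal_mul_I]; simp)).2.2
    rw [← h3]
    simp only [integral_gauss_smul]
    have h4 : ∀ x : ℝ, ∫ y : ℝ, Complex.exp (t * y * Complex.I) ∂(gaussianReal x 1) =
        Complex.exp (t * x * Complex.I) * Complex.exp (-(t ^ 2 / 2)) := fun x => by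
      rw [← charFun_apply_real, charFun_gaussianReal, ← Complex.exp_add]
      congr 1; simp; ring
    simp only [h4]
    rw [integral_mul_const, charFun_apply_real]
  apply Measure.ext_of_charFun
  ext t
  have h1 := key μ hμ t
  rw [h, key ν hν t] at h1
  exact (mul_right_cancel₀ (Complex.exp_ne_zero _) h1).symm

lemma maximizer_unique {γ q : ℝ} (hq : 0 < q) {μ ν : Measure ℝ}
    (hμ : memLam γ q μ) (hν : memLam γ q ν)
    (hμm : ∀ ρ, memLam γ q ρ → mutInfo ρ ≤ mutInfo μ)
    (hνm : ∀ ρ, memLam γ q ρ → mutInfo ρ ≤ mutInfo ν) : μ = ν := by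
  have i1 := hμ.1
  have i2 := hν.1
  have hh : (2⁻¹ : ENNReal) + 2⁻¹ = 1 := ENNReal.inv_two_add_inv_two
  set ρ : Measure ℝ := (2⁻¹ : ENNReal) • μ + (2⁻¹ : ENNReal) • ν with hρd
  have hρ : memLam γ q ρ := by
    refine ⟨⟨by simp [hρd, hh]⟩, ?_, ?_⟩
    · simp only [hρd, Measure.add_apply, Measure.smul_apply, smul_eq_mul]
      calc ENNReal.ofReal q = 2⁻¹ * ENNReal.ofReal q + 2⁻¹ * ENNReal.ofReal q := by
            rw [← add_mul, hh, one_mul]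
        _ ≤ _ := by gcongr; exacts [hμ.2.1, hν.2.1]
    · simp only [hρd, lintegral_add_measure, lintegral_smul_measure, smul_eq_mul]
      calc _ ≤ 2⁻¹ * ENNReal.ofReal γ + 2⁻¹ * ENNReal.ofReal γ := by
            gcongr; exacts [hμ.2.2, hν.2.2]
        _ = _ := by rw [← add_mul, hh, one_mul]
  have i3 := hρ.1
  have hout : ∀ y, outDen ρ y = (1 / 2 : ℝ) * outDen μ y + (1 / 2 : ℝ) * outDen ν y := fun y => by
    unfold outDen
    rw [hρd, integral_add_measure
      ((integrable_gauss_sub μ y).smul_measure (by simp))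
      ((integrable_gauss_sub ν y).smul_measure (by simp)),
      integral_smul_measure, integral_smul_measure]
    simp
  apply eq_of_outDen_eq hμ hν
  let D : ℝ → ℝ := fun y => negMulLog (outDen ρ y) -
    ((1 / 2 : ℝ) * negMulLog (outDen μ y) + (1 / 2 : ℝ) * negMulLog (outDen ν y))
  obtain ⟨a1, a2⟩ := mutInfo_formula hq hμ
  obtain ⟨b1, b2⟩ := mutInfo_formula hq hν
  obtain ⟨c1, c2⟩ := mutInfo_formula hq hρ
  have hDi : Integrable D := c1.sub ((a1.const_mul _).add (b1.const_mul _))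
  have hDc : Continuous D := by
    have l := Real.continuous_negMulLog
    exact (l.comp (continuous_outDen ρ)).sub (((l.comp (continuous_outDen μ)).const_mul _).add
      ((l.comp (continuous_outDen ν)).const_mul _))
  have hsc := Real.strictConcaveOn_negMulLog
  have hD0 : ∀ y, 0 ≤ D y := fun y => by
    have := hsc.concaveOn.2 (outDen_pos hq hμ y).le (outDen_pos hq hν y).le
      (by norm_num : (0 : ℝ) ≤ 1 / 2) (by norm_num : (0 : ℝ) ≤ 1 / 2) (by norm_num)
    simp only [smul_eq_mul, ← hout y] at this
    simp only [D]; linarith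
  have hDint : ∫ y, D y ≤ 0 := by
    simp only [D]
    have hab : Integrable (fun y => (1 / 2 : ℝ) * negMulLog (outDen μ y) +
        (1 / 2 : ℝ) * negMulLog (outDen ν y)) := (a1.const_mul _).add (b1.const_mul _)
    rw [integral_sub c1 hab,
      integral_add (a1.const_mul _) (b1.const_mul _), integral_const_mul, integral_const_mul]
    have e1 := hμm ρ hρ
    have e2 := hνm ρ hρ
    linarith
  have hDz : D = 0 := by
    have h1 := (integral_eq_zero_iff_of_nonneg hD0 hDi).1 (le_antisymm hDint (integral_nonneg hD0))
    exact (hDc.ae_eq_iff_eq volume continuous_zero).1 h1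
  ext y
  by_contra hne
  have := hsc.2 (outDen_pos hq hμ y).le (outDen_pos hq hν y).le hne
    (by norm_num : (0 : ℝ) < 1 / 2) (by norm_num : (0 : ℝ) < 1 / 2) (by norm_num)
  simp only [smul_eq_mul, ← hout y] at this
  have h0 := congrFun hDz y
  simp only [D, Pi.zero_apply] at h0
  linarith

/-- for `0 < q < 1` and `γ > 0`, the mutual information functional attains its
maximum over `Λ(γ,q)` at a unique maximizer `μ₀ ∈ Λ(γ,q)`. -/
theorem mutInfo_exists_unique_maximizer (q γ : ℝ) (hq0 : 0 < q) (hq1 : q < 1) (hγ : 0 < γ) :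
    ∃! μ₀ : Measure ℝ, memLam γ q μ₀ ∧ ∀ μ : Measure ℝ, memLam γ q μ → mutInfo μ ≤ mutInfo μ₀ := by
  obtain ⟨μ₀, h1, h2⟩ := exists_maximizer hq0 hq1 hγ
  exact ⟨μ₀, ⟨h1, h2⟩, fun ν hν => maximizer_unique hq0 hν.1 h1 hν.2 h2⟩
end

section
/- Let θ, a, b ∈ (0,1] and define f(θ) = (((1−θ)a + θb)/θ) · log(((1−θ)a + θb)/a). Then f is nondecreasing on (0,1], b − a ≤ f(θ) ≤ b log(b/a), and consequently |f(θ)| ≤ b + a − b log b − b log a for all θ ∈ (0,1]. -/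
open Real Set

/-- for `θ, a, b ∈ (0,1]` and
`f(θ) = (((1−θ)a + θb)/θ) · log(((1−θ)a + θb)/a)`, the function `f` is nondecreasing on
`(0,1]`, satisfies `b − a ≤ f(θ) ≤ b log(b/a)`, and consequently
`|f(θ)| ≤ b + a − b log b − b log a` for all `θ ∈ (0,1]`. -/
theorem mixture_log_bound (a b : ℝ) (ha : a ∈ Set.Ioc (0 : ℝ) 1) (hb : b ∈ Set.Ioc (0 : ℝ) 1) :
    MonotoneOn
      (fun θ : ℝ => ((1 - θ) * a + θ * b) / θ * Real.log (((1 - θ) * a + θ * b) / a))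
      (Set.Ioc (0 : ℝ) 1) ∧
    ∀ θ ∈ Set.Ioc (0 : ℝ) 1,
      (b - a ≤ ((1 - θ) * a + θ * b) / θ * Real.log (((1 - θ) * a + θ * b) / a)) ∧
      (((1 - θ) * a + θ * b) / θ * Real.log (((1 - θ) * a + θ * b) / a) ≤ b * Real.log (b / a)) ∧
      (|((1 - θ) * a + θ * b) / θ * Real.log (((1 - θ) * a + θ * b) / a)| ≤
        b + a - b * Real.log b - b * Real.log a) := by
  obtain ⟨ha0, ha1⟩ := ha
  obtain ⟨hb0, hb1⟩ := hb
  have hw : ∀ θ ∈ Set.Ioc (0 : ℝ) 1, 0 < (1 - θ) * a + θ * b := by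
    rintro θ ⟨h0, h1⟩
    have h2 : 0 ≤ (1 - θ) * a := mul_nonneg (by linarith) ha0.le
    have h3 : 0 < θ * b := mul_pos h0 hb0
    linarith
  have hmono : MonotoneOn
      (fun θ : ℝ => ((1 - θ) * a + θ * b) / θ * Real.log (((1 - θ) * a + θ * b) / a))
      (Set.Ioc (0 : ℝ) 1) := by
    intro s hs t ht hst
    have hws := hw s hs
    have hwt := hw t ht
    have hs0 : 0 < s := hs.1
    have ht0 : 0 < t := ht.1
    have hq : s / t ≤ 1 := (div_le_one ht0).2 hst
    have hc := Real.convexOn_mul_log.2 (show (1 : ℝ) ∈ Set.Ici (0 : ℝ) by simp)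
      (show ((1 - t) * a + t * b) / a ∈ Set.Ici (0 : ℝ) from (div_pos hwt ha0).le)
      (show 0 ≤ 1 - s / t by linarith) (show 0 ≤ s / t by positivity) (by ring)
    have he : (1 - s / t) • (1 : ℝ) + (s / t) • (((1 - t) * a + t * b) / a)
        = ((1 - s) * a + s * b) / a := by
      simp only [smul_eq_mul]
      field_simp
      ring
    rw [he] at hc
    simp only [smul_eq_mul, Real.log_one, mul_zero, zero_add] at hc
    show ((1 - s) * a + s * b) / s * Real.log (((1 - s) * a + s * b) / a)
      ≤ ((1 - t) * a + t * b) / t * Real.log (((1 - t) * a + t * b) / a)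
    have hm := mul_le_mul_of_nonneg_left hc (div_pos ha0 hs0).le
    generalize Real.log (((1 - s) * a + s * b) / a) = L at hm ⊢
    generalize Real.log (((1 - t) * a + t * b) / a) = M at hm ⊢
    calc _ = a / s * (((1 - s) * a + s * b) / a * L) := by field_simp
      _ ≤ _ := hm
      _ = _ := by field_simp
  refine ⟨hmono, fun θ hθ => ?_⟩
  have h0 : 0 < θ := hθ.1
  have hwθ := hw θ hθ
  have hlow : b - a ≤ ((1 - θ) * a + θ * b) / θ * Real.log (((1 - θ) * a + θ * b) / a) := by
    have hl := Real.one_sub_inv_le_log_of_pos (div_pos hwθ ha0)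
    have hm := mul_le_mul_of_nonneg_left hl (div_pos hwθ h0).le
    refine le_trans (le_of_eq ?_) hm
    have hne := hwθ.ne'
    rw [inv_div, mul_sub, mul_one, div_mul_div_comm, mul_comm θ (_ + _), mul_div_mul_left _ _ hne]
    field_simp
    ring
  have hup : ((1 - θ) * a + θ * b) / θ * Real.log (((1 - θ) * a + θ * b) / a)
      ≤ b * Real.log (b / a) := by
    have := hmono hθ (show (1 : ℝ) ∈ Set.Ioc (0 : ℝ) 1 by simp) hθ.2
    simpa using this
  refine ⟨hlow, hup, ?_⟩
  have hla : b * Real.log a ≤ 0 :=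
    mul_nonpos_of_nonneg_of_nonpos hb0.le (Real.log_nonpos ha0.le ha1)
  have hlb : b * Real.log b ≤ 0 :=
    mul_nonpos_of_nonneg_of_nonpos hb0.le (Real.log_nonpos hb0.le hb1)
  rw [Real.log_div hb0.ne' ha0.ne', mul_sub] at hup
  rw [abs_le]
  constructor <;> linarith
end
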